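/- arXiv:1912.07597 — 11 statements merged into one kernel-verified Lean document; each statement's English description precedes it below -/
import Mathlib

section
/- (Darboux–Crum formula.) Let U : ℝ → ℝ be smooth, let φ_1, …, φ_n : ℝ → ℝ be smooth with −φ_i'' + U·φ_i = λ_i·φ_i for constants λ_i ∈ ℝ, and let ψ : ℝ → ℝ be smooth with −ψ'' + U·ψ = E·ψ for E ∈ ℝ. Assume that for each j = 1, …, n the Wronskian Wr[φ_1, …, φ_j] vanishes nowhere on ℝ. Set W := Wr[φ_1, …, φ_n], U_n := U − 2·(W'/W)', and ψ⁽ⁿ⁾ := Wr[φ_1, …, φ_n, ψ]/W. Then −(ψ⁽ⁿ⁾)'' + U_n·ψ⁽ⁿ⁾ = E·ψ⁽ⁿ⁾ pointwise on ℝ. -/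
/-- The Wronskian of `n` functions `f i : ℝ → ℝ`: the determinant of the `n × n` matrix whose
`(i, j)` entry is the `j`-th derivative of `f i`. -/
noncomputable def Wronskian (n : ℕ) (f : Fin n → ℝ → ℝ) (x : ℝ) : ℝ :=
  Matrix.det (Matrix.of fun i j : Fin n => deriv^[(j : ℕ)] (f i) x)

/-- The Darboux transform of `g` with seed function `f`. -/
noncomputable def darbouxTransform (f g : ℝ → ℝ) (x : ℝ) : ℝ :=
  deriv g x - deriv f x / f x * g x

theorem contDiff_deriv_of_smooth {f : ℝ → ℝ} (hf : ContDiff ℝ (⊤ : ℕ∞) f) :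
    ContDiff ℝ (⊤ : ℕ∞) (deriv f) :=
  (contDiff_infty_iff_deriv.1 hf).2

theorem contDiff_logDeriv_of_smooth {f : ℝ → ℝ} (hf : ContDiff ℝ (⊤ : ℕ∞) f)
    (hf0 : ∀ x, f x ≠ 0) : ContDiff ℝ (⊤ : ℕ∞) (fun x => deriv f x / f x) :=
  (contDiff_deriv_of_smooth hf).div hf hf0

theorem contDiff_darbouxTransform {f g : ℝ → ℝ} (hf : ContDiff ℝ (⊤ : ℕ∞) f)
    (hg : ContDiff ℝ (⊤ : ℕ∞) g) (hf0 : ∀ x, f x ≠ 0) :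
    ContDiff ℝ (⊤ : ℕ∞) (darbouxTransform f g) :=
  (contDiff_deriv_of_smooth hg).sub ((contDiff_logDeriv_of_smooth hf hf0).mul hg)

theorem darbouxTransform_self {f : ℝ → ℝ} (hf0 : ∀ x, f x ≠ 0) :
    darbouxTransform f f = fun _ => 0 := by
  funext x
  have := hf0 x
  simp only [darbouxTransform]
  field_simp
  ring

theorem iteratedDeriv_darbouxTransform {f g : ℝ → ℝ} (hf : ContDiff ℝ (⊤ : ℕ∞) f)
    (hg : ContDiff ℝ (⊤ : ℕ∞) g) (hf0 : ∀ x, f x ≠ 0) (j : ℕ) (x : ℝ) :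
    iteratedDeriv j (darbouxTransform f g) x = iteratedDeriv (j + 1) g x -
      ∑ k ∈ Finset.range (j + 1), (j.choose k : ℝ) *
        iteratedDeriv (j - k) (fun x => deriv f x / f x) x * iteratedDeriv k g x := by
  have hj : ((j : ℕ∞) : WithTop ℕ∞) ≤ ((⊤ : ℕ∞) : WithTop ℕ∞) := by exact_mod_cast le_top
  have hv := contDiff_logDeriv_of_smooth hf hf0
  have hd := contDiff_deriv_of_smooth hg
  have h : darbouxTransform f g = fun x => deriv g x - g x * (deriv f x / f x) := by
    funext x
    simp only [darbouxTransform]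
    ring
  rw [h, iteratedDeriv_fun_sub (hd.of_le hj).contDiffAt ((hg.mul hv).of_le hj).contDiffAt,
    iteratedDeriv_fun_mul (hg.of_le hj).contDiffAt (hv.of_le hj).contDiffAt,
    iteratedDeriv_succ']
  congr 1
  exact Finset.sum_congr rfl fun k _ => by ring

/-- Crum's reduction: the first function splits off from a Wronskian. -/
theorem Wronskian_succ_eq (n : ℕ) (F : Fin (n + 1) → ℝ → ℝ)
    (hF : ∀ i, ContDiff ℝ (⊤ : ℕ∞) (F i)) (hF0 : ∀ x, F 0 x ≠ 0) (x : ℝ) :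
    Wronskian (n + 1) F x =
      F 0 x * Wronskian n (fun i => darbouxTransform (F 0) (F i.succ)) x := by
  set A : Matrix (Fin (n + 1)) (Fin (n + 1)) ℝ :=
    Matrix.of fun i j => iteratedDeriv (j : ℕ) (F i) x with hA
  set v : ℝ → ℝ := fun x => deriv (F 0) x / F 0 x
  let c : ℕ → ℕ → ℝ := fun j k =>
    if k < j + 1 then (j.choose k : ℝ) * iteratedDeriv (j - k) v x else 0
  let C : Matrix (Fin (n + 1)) (Fin (n + 1)) ℝ := Matrix.of fun k j =>
    Fin.cases (if k = 0 then 1 else 0)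
      (fun j' : Fin n => (if k = j'.succ then 1 else 0) - c j' k) j
  let B : Matrix (Fin (n + 1)) (Fin (n + 1)) ℝ := Matrix.of fun i j =>
    Fin.cases (F i x) (fun j' : Fin n => iteratedDeriv (j' : ℕ) (darbouxTransform (F 0) (F i)) x) j
  have hCdet : C.det = 1 := by
    rw [Matrix.det_of_isUpperTriangular]
    · refine Finset.prod_eq_one fun i _ => ?_
      cases i using Fin.cases <;> simp [C, c]
    · intro i j hij
      have hij : j < i := hij
      cases j using Fin.cases with
      | zero => simp [C, hij.ne']
      | succ j =>
        have h : (j : ℕ) + 1 < i := hij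
        simp only [C, c, Matrix.of_apply, Fin.cases_succ, if_neg hij.ne',
          if_neg (show ¬ (i : ℕ) < j + 1 by omega), sub_zero]
  have hAC : A * C = B := by
    ext i j
    rw [Matrix.mul_apply]
    cases j using Fin.cases with
    | zero => simp [A, C, B]
    | succ j =>
      simp only [A, C, B, Matrix.of_apply, Fin.cases_succ, mul_sub, Finset.sum_sub_distrib]
      rw [iteratedDeriv_darbouxTransform (hF 0) (hF i) hF0]
      congr 1
      · simp
      · rw [Fin.sum_univ_eq_sum_range
          (fun k => iteratedDeriv k (F i) x * c j k) (n + 1)]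
        have hsub : Finset.range ((j : ℕ) + 1) ⊆ Finset.range (n + 1) :=
          Finset.range_subset_range.2 (by omega)
        rw [← Finset.sum_subset hsub]
        · refine Finset.sum_congr rfl fun k hk => ?_
          simp only [c, if_pos (Finset.mem_range.1 hk)]
          ring
        · intro k _ hk
          simp only [c, if_neg (fun h => hk (Finset.mem_range.2 h)), mul_zero]
  have hWA : Wronskian (n + 1) F x = A.det := by
    simp only [Wronskian, hA, iteratedDeriv_eq_iterate]
  have hWB : B.det = F 0 x * Wronskian n (fun i => darbouxTransform (F 0) (F i.succ)) x := by
    rw [Matrix.det_succ_row_zero, Fin.sum_univ_succ]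
    simp only [Wronskian, ← iteratedDeriv_eq_iterate]
    simp [B, darbouxTransform_self hF0, Matrix.submatrix]
  rw [hWA, ← hWB, ← hAC, Matrix.det_mul, hCdet, mul_one]

theorem deriv_logDeriv_eq {U f : ℝ → ℝ} {l : ℝ} (hf : ContDiff ℝ (⊤ : ℕ∞) f)
    (hf0 : ∀ x, f x ≠ 0) (hfeq : ∀ x, -(deriv (deriv f) x) + U x * f x = l * f x) (x : ℝ) :
    deriv (fun t => deriv f t / f t) x = U x - l - (deriv f x / f x) ^ 2 := by
  have h0 := hf0 x
  have hd := (contDiff_deriv_of_smooth hf).differentiable (by simp) x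
  rw [deriv_fun_div hd (hf.differentiable (by simp) x) h0]
  have := hfeq x
  field_simp
  linear_combination (-f x) * this

/-- One-step Darboux transformation. -/
theorem darbouxTransform_eigen {U f g : ℝ → ℝ} {l E : ℝ} (hf : ContDiff ℝ (⊤ : ℕ∞) f)
    (hg : ContDiff ℝ (⊤ : ℕ∞) g) (hf0 : ∀ x, f x ≠ 0)
    (hfeq : ∀ x, -(deriv (deriv f) x) + U x * f x = l * f x)
    (hgeq : ∀ x, -(deriv (deriv g) x) + U x * g x = E * g x) (x : ℝ) :
    -(deriv (deriv (darbouxTransform f g)) x) +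
      (U x - 2 * deriv (fun t => deriv f t / f t) x) * darbouxTransform f g x =
      E * darbouxTransform f g x := by
  have hv : Differentiable ℝ (fun t => deriv f t / f t) :=
    (contDiff_logDeriv_of_smooth hf hf0).differentiable (by simp)
  have hdg : Differentiable ℝ (deriv g) := (contDiff_deriv_of_smooth hg).differentiable (by simp)
  have hg' : Differentiable ℝ g := hg.differentiable (by simp)
  have hT : Differentiable ℝ (darbouxTransform f g) :=
    (contDiff_darbouxTransform hf hg hf0).differentiable (by simp)
  have hv' := deriv_logDeriv_eq hf hf0 hfeq
  have h1 : deriv (darbouxTransform f g) =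
      fun t => (l - E) * g t - deriv f t / f t * darbouxTransform f g t := by
    funext t
    have h : HasDerivAt (darbouxTransform f g) _ t :=
      (hdg t).hasDerivAt.sub ((hv t).hasDerivAt.mul (hg' t).hasDerivAt)
    rw [h.deriv, hv' t, darbouxTransform]
    linear_combination -hgeq t
  have h2 := (((hg' x).hasDerivAt.const_mul (l - E)).sub
    ((hv x).hasDerivAt.mul (hT x).hasDerivAt)).deriv
  have h3 : deriv (deriv (darbouxTransform f g)) x = (l - E) * deriv g x -
      (deriv (fun t => deriv f t / f t) x * darbouxTransform f g x +
        deriv f x / f x * deriv (darbouxTransform f g) x) := by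
    conv_lhs => rw [h1]
    exact h2
  rw [h3, h1, hv' x]
  simp only [darbouxTransform]
  ring

theorem contDiff_Wronskian (n : ℕ) (F : Fin n → ℝ → ℝ)
    (hF : ∀ i, ContDiff ℝ (⊤ : ℕ∞) (F i)) : ContDiff ℝ (⊤ : ℕ∞) (Wronskian n F) := by
  have h : Wronskian n F = fun x => ∑ σ : Equiv.Perm (Fin n), ((σ.sign : ℤ) : ℝ) *
      ∏ i : Fin n, deriv^[(i : ℕ)] (F (σ i)) x := by
    funext x
    simp [Wronskian, Matrix.det_apply']
  rw [h]
  refine ContDiff.sum fun σ _ => contDiff_const.mul (contDiff_prod fun i _ => ?_)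
  induction (i : ℕ) with
  | zero => exact hF _
  | succ k ih =>
    rw [Function.iterate_succ_apply']
    exact contDiff_deriv_of_smooth ih

theorem deriv_logDeriv_mul {f g : ℝ → ℝ} (hf : ContDiff ℝ (⊤ : ℕ∞) f)
    (hg : ContDiff ℝ (⊤ : ℕ∞) g) (hf0 : ∀ x, f x ≠ 0) (hg0 : ∀ x, g x ≠ 0) (x : ℝ) :
    deriv (fun t => deriv (fun s => f s * g s) t / (f t * g t)) x =
      deriv (fun t => deriv f t / f t) x + deriv (fun t => deriv g t / g t) x := by
  rw [← deriv_fun_add ((contDiff_logDeriv_of_smooth hf hf0).differentiable (by simp) x)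
    ((contDiff_logDeriv_of_smooth hg hg0).differentiable (by simp) x)]
  congr 1
  funext t
  have h1 := hf0 t
  have h2 := hg0 t
  rw [deriv_fun_mul (hf.differentiable (by simp) t) (hg.differentiable (by simp) t)]
  field_simp

/-- Darboux–Crum formula: if `−φᵢ'' + U·φᵢ = λᵢ·φᵢ` and `−ψ'' + U·ψ = E·ψ`,
all functions smooth, and all the partial Wronskians `Wr[φ₁,…,φⱼ]` vanish nowhere, then
`ψ⁽ⁿ⁾ = Wr[φ₁,…,φₙ,ψ]/Wr[φ₁,…,φₙ]` satisfies `−(ψ⁽ⁿ⁾)'' + Uₙ·ψ⁽ⁿ⁾ = E·ψ⁽ⁿ⁾`, where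
`Uₙ = U − 2(log Wr[φ₁,…,φₙ])''`. -/
theorem darboux_crum_formula
    (n : ℕ) (U : ℝ → ℝ) (hU : ContDiff ℝ (⊤ : ℕ∞) U)
    (φ : Fin n → ℝ → ℝ) (hφ : ∀ i, ContDiff ℝ (⊤ : ℕ∞) (φ i))
    (lam : Fin n → ℝ)
    (hφeq : ∀ i, ∀ x, -(deriv (deriv (φ i)) x) + U x * φ i x = lam i * φ i x)
    (ψ : ℝ → ℝ) (hψ : ContDiff ℝ (⊤ : ℕ∞) ψ) (E : ℝ)
    (hψeq : ∀ x, -(deriv (deriv ψ) x) + U x * ψ x = E * ψ x)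
    (hW0 : ∀ j : Fin n, ∀ x,
      Wronskian ((j : ℕ) + 1) (fun i => φ (Fin.castLE j.isLt i)) x ≠ 0)
    (W : ℝ → ℝ) (hW : W = Wronskian n φ)
    (Un : ℝ → ℝ) (hUn : Un = fun x => U x - 2 * deriv (fun t => deriv W t / W t) x)
    (ψn : ℝ → ℝ) (hψn : ψn = fun x => Wronskian (n + 1) (Fin.snoc φ ψ) x / W x) :
    ∀ x, -(deriv (deriv ψn) x) + Un x * ψn x = E * ψn x := by
  subst hW hUn hψn
  induction n generalizing U ψ with
  | zero =>
    intro x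
    have h0 : Wronskian 0 φ = fun _ => 1 := by
      funext t
      simp [Wronskian]
    have h1 : ∀ t, Wronskian (0 + 1) (Fin.snoc φ ψ : Fin (0 + 1) → ℝ → ℝ) t = ψ t := by
      intro t
      simp [Wronskian, Fin.snoc]
    simp only [h0, h1]
    simpa using hψeq x
  | succ n ih =>
    have hf0 : ∀ x, φ 0 x ≠ 0 := fun x h =>
      hW0 0 x ((Matrix.det_fin_one _).trans h)
    have hW1 : ∀ x, Wronskian (n + 1) φ x =
        φ 0 x * Wronskian n (fun i => darbouxTransform (φ 0) (φ i.succ)) x :=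
      Wronskian_succ_eq n φ hφ hf0
    have hsnoc : ∀ x, Wronskian (n + 1 + 1) (Fin.snoc φ ψ : Fin (n + 1 + 1) → ℝ → ℝ) x =
        φ 0 x * Wronskian (n + 1) (Fin.snoc (fun i => darbouxTransform (φ 0) (φ i.succ))
          (darbouxTransform (φ 0) ψ) : Fin (n + 1) → ℝ → ℝ) x := by
      intro x
      have hz : (Fin.snoc φ ψ : Fin (n + 1 + 1) → ℝ → ℝ) 0 = φ 0 :=
        Fin.snoc_castSucc (α := fun _ => ℝ → ℝ) ψ φ 0
      have hs : ∀ i, ContDiff ℝ (⊤ : ℕ∞) ((Fin.snoc φ ψ : Fin (n + 1 + 1) → ℝ → ℝ) i) := by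
        intro i
        cases i using Fin.lastCases with
        | last => simpa using hψ
        | cast i => simpa using hφ i
      rw [Wronskian_succ_eq (n + 1) _ hs (by rwa [hz]), hz]
      congr 2
      funext i
      cases i using Fin.lastCases with
      | last => rw [Fin.succ_last, Fin.snoc_last, Fin.snoc_last]
      | cast i => rw [Fin.succ_castSucc, Fin.snoc_castSucc, Fin.snoc_castSucc]
    have hpart : ∀ (j : Fin n) (x : ℝ), Wronskian ((j : ℕ) + 1)
        (fun i => darbouxTransform (φ 0) (φ (Fin.castLE j.isLt i).succ)) x ≠ 0 := by
      intro j x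
      have h := hW0 j.succ x
      have h' := Wronskian_succ_eq ((j : ℕ) + 1)
        (fun i => φ (Fin.castLE j.succ.isLt i)) (fun i => hφ _) hf0 x
      exact right_ne_zero_of_mul (h'.symm.trans_ne h)
    have hWne : ∀ x, Wronskian n (fun i => darbouxTransform (φ 0) (φ i.succ)) x ≠ 0 := fun x =>
      right_ne_zero_of_mul ((hW1 x).symm.trans_ne (hW0 (Fin.last n) x))
    have hgs := fun i : Fin n => contDiff_darbouxTransform (hφ 0) (hφ i.succ) hf0
    have key := ih (fun x => U x - 2 * deriv (fun t => deriv (φ 0) t / φ 0 t) x)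
      (hU.sub (contDiff_const.mul (contDiff_deriv_of_smooth
        (contDiff_logDeriv_of_smooth (hφ 0) hf0))))
      (fun i => darbouxTransform (φ 0) (φ i.succ)) hgs (fun i => lam i.succ)
      (fun i => darbouxTransform_eigen (hφ 0) (hφ i.succ) hf0 (hφeq 0) (hφeq i.succ))
      (darbouxTransform (φ 0) ψ) (contDiff_darbouxTransform (hφ 0) hψ hf0)
      (darbouxTransform_eigen (hφ 0) hψ hf0 (hφeq 0) hψeq) hpart
    intro x
    have hx := key x
    have hW2 : Wronskian (n + 1) φ = fun x =>
        φ 0 x * Wronskian n (fun i => darbouxTransform (φ 0) (φ i.succ)) x := funext hW1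
    simp only [hsnoc, hW2, mul_div_mul_left _ _ (hf0 _)]
    rw [deriv_logDeriv_mul (hφ 0) (contDiff_Wronskian n _ hgs) hf0 hWne x]
    linear_combination hx
end

section
/- For every n ≥ 0 and all smooth functions f_1, …, f_n, g, h : ℝ → ℝ, the following Wronskian identity holds pointwise on ℝ: Wr[f_1, …, f_n, g, h] · Wr[f_1, …, f_n] = Wr[ Wr[f_1, …, f_n, g], Wr[f_1, …, f_n, h] ], where the outer Wronskian of the two functions F = Wr[f_1,…,f_n,g] and G = Wr[f_1,…,f_n,h] is F·G' − G·F'. -/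
open Matrix Polynomial in
/-- A Desnanot–Jacobi type identity for a matrix with a border of width two: the product of its
determinant with that of the inner block is a `2 × 2` determinant of minors with a border of
width one. -/
theorem Matrix.det_fromBlocks_mul_det_fin_two {m R : Type*} [Fintype m] [DecidableEq m]
    [CommRing R] (A : Matrix m m R) (B : Matrix m (Fin 2) R) (C : Matrix (Fin 2) m R)
    (D : Matrix (Fin 2) (Fin 2) R) :
    let E : Fin 2 → Fin 2 → R := fun i j =>
      (fromBlocks A (B.submatrix id fun _ : Fin 1 => j) (C.submatrix (fun _ : Fin 1 => i) id)
        (D.submatrix (fun _ => i) fun _ => j)).det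
    (fromBlocks A B C D).det * A.det = E 0 0 * E 1 1 - E 0 1 * E 1 0 := by
  intro E
  let S := Localization.Away (-A).charpoly
  let φ : R[X] →+* S := algebraMap R[X] S
  have hφ : Function.Injective φ := by
    refine IsLocalization.injective S (M := Submonoid.powers (-A).charpoly) ?_
    exact Submonoid.powers_le.2 (-A).charpoly_monic.mem_nonZeroDivisors
  let A' : Matrix m m R[X] := charmatrix (-A)
  let E' : Fin 2 → Fin 2 → R[X] := fun i j =>
    (fromBlocks A' ((B.map Polynomial.C).submatrix id fun _ : Fin 1 => j)
      ((C.map Polynomial.C).submatrix (fun _ : Fin 1 => i) id)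
      ((D.map Polynomial.C).submatrix (fun _ => i) fun _ => j)).det
  have key : (fromBlocks A' (B.map Polynomial.C) (C.map Polynomial.C) (D.map Polynomial.C)).det
      * A'.det = E' 0 0 * E' 1 1 - E' 0 1 * E' 1 0 := by
    apply hφ
    have hu : IsUnit (A'.map φ).det := by
      have h := IsLocalization.Away.algebraMap_isUnit (S := S) (-A).charpoly
      change IsUnit (φ A'.det) at h
      rwa [RingHom.map_det] at h
    let _ : Invertible (A'.map φ) := invertibleOfIsUnitDet _ hu
    simp only [E', map_mul, map_sub, RingHom.map_det, RingHom.mapMatrix_apply, fromBlocks_map,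
      det_fromBlocks₁₁, det_fin_two, det_fin_one]
    simp only [sub_apply, mul_apply, map_apply, submatrix_apply, id]
    ring
  have h0 : A'.map (evalRingHom 0) = A := by
    ext i j
    by_cases h : i = j <;> simp [A', h]
  have hC : evalRingHom (0 : R) ∘ Polynomial.C = id := by
    ext a
    simp
  have h := congrArg (evalRingHom 0) key
  simpa only [E', map_mul, map_sub, RingHom.map_det, RingHom.mapMatrix_apply, fromBlocks_map,
    submatrix_map, Matrix.map_map, h0, hC, Matrix.map_id] using h

/-- The derivative of a determinant, obtained by differentiating one row at a time. -/
theorem HasDerivAt.matrix_det {𝕜 m : Type*} [NontriviallyNormedField 𝕜] [Fintype m]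
    [DecidableEq m] {A : 𝕜 → Matrix m m 𝕜} {A' : Matrix m m 𝕜} {x : 𝕜}
    (hA : ∀ i j, HasDerivAt (fun t => A t i j) (A' i j) x) :
    HasDerivAt (fun t => (A t).det) (∑ i, ((A x).updateRow i (A' i)).det) x := by
  let d : ContinuousMultilinearMap 𝕜 (fun _ : m => m → 𝕜) 𝕜 :=
    ⟨(Matrix.detRowAlternating (R := 𝕜) (n := m)).toMultilinearMap,
      Continuous.matrix_det continuous_id⟩
  have hA' : HasDerivAt (fun t => (A t : m → m → 𝕜)) A' x :=
    hasDerivAt_pi.2 fun i => hasDerivAt_pi.2 fun j => hA i j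
  have h := (d.hasFDerivAt (A x)).comp_hasDerivAt x hA'
  exact h.congr_deriv (ContinuousMultilinearMap.linearDeriv_apply d (A x) A')

theorem ContDiff.hasDerivAt_iterate_deriv {f : ℝ → ℝ} (hf : ContDiff ℝ (⊤ : ℕ∞) f) (k : ℕ)
    (x : ℝ) : HasDerivAt (deriv^[k] f) (deriv^[k + 1] f x) x := by
  rw [Function.iterate_succ_apply']
  exact ((hf.iterate_deriv k).differentiable (by simp)).differentiableAt.hasDerivAt

/-- The derivative of a Wronskian only differentiates the column of highest derivatives. -/
theorem hasDerivAt_wronskian_succ {n : ℕ} {f : Fin (n + 1) → ℝ → ℝ}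
    (hf : ∀ i, ContDiff ℝ (⊤ : ℕ∞) (f i)) (x : ℝ) :
    HasDerivAt (Wronskian (n + 1) f)
      (Matrix.of fun i j : Fin (n + 1) =>
        deriv^[if j = Fin.last n then n + 1 else j] (f i) x).det x := by
  have h := HasDerivAt.matrix_det (x := x)
    (A := fun t => Matrix.of fun j i : Fin (n + 1) => deriv^[(j : ℕ)] (f i) t)
    (A' := Matrix.of fun j i : Fin (n + 1) => deriv^[(j : ℕ) + 1] (f i) x)
    fun j i => (hf i).hasDerivAt_iterate_deriv j x
  have hW : Wronskian (n + 1) f =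
      fun t => (Matrix.of fun j i : Fin (n + 1) => deriv^[(j : ℕ)] (f i) t).det :=
    funext fun t => (Matrix.det_transpose _).symm
  rw [hW]
  refine h.congr_deriv ?_
  rw [Finset.sum_eq_single (Fin.last n), ← Matrix.det_transpose]
  · congr 1
    ext j i
    by_cases hi : i = Fin.last n <;> simp [Matrix.updateRow_apply, hi]
  · intro j _ hj
    obtain ⟨k, rfl⟩ := Fin.exists_castSucc_eq.2 hj
    refine Matrix.det_zero_of_row_eq (i := k.castSucc) (j := k.succ) (Fin.castSucc_lt_succ).ne ?_
    ext i
    simp [Matrix.updateRow_apply, (Fin.castSucc_lt_succ (i := k)).ne']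
  · simp

/-- the Wronskian identity
`Wr[f₁,…,fₙ,g,h] · Wr[f₁,…,fₙ] = Wr[Wr[f₁,…,fₙ,g], Wr[f₁,…,fₙ,h]]`,
where the outer Wronskian of `F` and `G` is `F·G' − G·F'`. -/
theorem wronskian_composition_identity
    (n : ℕ) (f : Fin n → ℝ → ℝ) (g h : ℝ → ℝ)
    (hf : ∀ i, ContDiff ℝ (⊤ : ℕ∞) (f i)) (hg : ContDiff ℝ (⊤ : ℕ∞) g) (hh : ContDiff ℝ (⊤ : ℕ∞) h)
    (F G : ℝ → ℝ)
    (hF : F = Wronskian (n + 1) (Fin.snoc f g))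
    (hG : G = Wronskian (n + 1) (Fin.snoc f h)) :
    ∀ x, Wronskian (n + 2) (Fin.snoc (Fin.snoc f g) h) x * Wronskian n f x
        = F x * deriv G x - G x * deriv F x := by
  intro x
  have hsnoc : ∀ u : ℝ → ℝ, ContDiff ℝ (⊤ : ℕ∞) u →
      ∀ i, ContDiff ℝ (⊤ : ℕ∞) ((Fin.snoc f u : Fin (n + 1) → ℝ → ℝ) i) := by
    intro u hu i
    induction i using Fin.lastCases with
    | last => simpa using hu
    | cast i => simpa using hf i
  subst hF hG
  rw [(hasDerivAt_wronskian_succ (hsnoc g hg) x).deriv,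
    (hasDerivAt_wronskian_succ (hsnoc h hh) x).deriv]
  have key := Matrix.det_fromBlocks_mul_det_fin_two
    (Matrix.of fun i j : Fin n => deriv^[(j : ℕ)] (f i) x)
    (Matrix.of fun i (j : Fin 2) => deriv^[n + j] (f i) x)
    (Matrix.of fun (i : Fin 2) (j : Fin n) => deriv^[(j : ℕ)] (![g, h] i) x)
    (Matrix.of fun (i : Fin 2) (j : Fin 2) => deriv^[n + j] (![g, h] i) x)
  convert key using 1
  · congr 1
    rw [Wronskian, ← Matrix.det_submatrix_equiv_self (finSumFinEquiv (m := n) (n := 2))]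
    congr 1
    have hl : ∀ i : Fin n, (Fin.snoc (Fin.snoc f g : Fin (n + 1) → ℝ → ℝ) h : Fin (n + 2) → ℝ → ℝ)
        (Fin.castAdd 2 i) = f i := fun i => by
      rw [show Fin.castAdd 2 i = i.castSucc.castSucc from rfl, Fin.snoc_castSucc,
        Fin.snoc_castSucc]
    have hr : ∀ i : Fin 2, (Fin.snoc (Fin.snoc f g : Fin (n + 1) → ℝ → ℝ) h : Fin (n + 2) → ℝ → ℝ)
        (Fin.natAdd n i) = ![g, h] i := fun i => by
      fin_cases i
      · change Fin.snoc (α := fun _ => ℝ → ℝ) _ _ (Fin.last n).castSucc = g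
        rw [Fin.snoc_castSucc, Fin.snoc_last]
      · change Fin.snoc (α := fun _ => ℝ → ℝ) _ _ (Fin.last (n + 1)) = h
        rw [Fin.snoc_last]
    ext (i | i) (j | j) <;> simp [hl, hr]
  · have hl : ∀ (u : ℝ → ℝ) (i : Fin n), (Fin.snoc f u : Fin (n + 1) → ℝ → ℝ)
        (Fin.castAdd 1 i) = f i := fun u i => Fin.snoc_castSucc (α := fun _ => ℝ → ℝ) ..
    have hc : ∀ j : Fin n, Fin.castAdd 1 j ≠ Fin.last n := fun j => j.castSucc_ne_last
    have hd : ∀ j : Fin 1, Fin.natAdd n j = Fin.last n := fun j => by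
      rw [Subsingleton.elim j 0]
      rfl
    simp only [Wronskian, ← Matrix.det_submatrix_equiv_self (finSumFinEquiv (m := n) (n := 1))]
    have hcongr : ∀ a b c d a' b' c' d' : ℝ, a = a' → b = b' → c = c' → d = d' →
        a * b - c * d = a' * b' - d' * c' := by
      rintro a b c d _ _ _ _ rfl rfl rfl rfl
      ring
    apply hcongr <;> congr 1 <;> ext (i | i) (j | j) <;> simp [hl, hc, hd]
end

section
/- Let λ ∈ ℝ and let y : ℝ → ℝ be a twice differentiable function, not identically zero, satisfying the Hermite differential equation y''(x) − 2x·y'(x) + λ·y(x) = 0 for all x ∈ ℝ, and suppose that ∫_ℝ y(x)² e^{−x²} dx < ∞. Then there exists n ∈ ℕ such that λ = 2n, and there exists a nonzero constant c ∈ ℝ such that y(x) = c·H_n(x) for all x; that is, the Hermite polynomials are precisely the solutions of the Hermite equation that are square-integrable with respect to the weight e^{−x²} on ℝ. -/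
open Polynomial

/-- The physicists' Hermite polynomials: `H₀ = 1`, `H_{n+1} = 2·X·H_n − (H_n)'`. -/
noncomputable def hermitePoly : ℕ → Polynomial ℝ
  | 0 => 1
  | n + 1 => 2 * X * hermitePoly n - derivative (hermitePoly n)

open MeasureTheory Filter Topology

/-- A Caccioppoli-type bound: cutting off by `1 - (x / R)²` on `[-R, R]` with `R = 2r`, the weighted
Dirichlet energy of a solution of the Hermite equation is controlled by its weighted norm. -/
theorem hermite_ode_intervalIntegral_deriv_sq_le {lam : ℝ} {y : ℝ → ℝ}
    (hy : Differentiable ℝ y) (hy' : Differentiable ℝ (deriv y))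
    (heq : ∀ x, deriv (deriv y) x - 2 * x * deriv y x + lam * y x = 0)
    (hint : Integrable (fun x => (y x) ^ 2 * Real.exp (-x ^ 2))) {r : ℝ} (hr : 0 < r) :
    ∫ x in (-r)..r, (deriv y x) ^ 2 * Real.exp (-x ^ 2) ≤
      4 * (2 / r ^ 2 + max lam 0) * ∫ x, (y x) ^ 2 * Real.exp (-x ^ 2) := by
  have hyc := hy.continuous
  have hyc' := hy'.continuous
  set φ : ℝ → ℝ := fun x => 1 - (x / (2 * r)) ^ 2 with hφ
  set D : ℝ → ℝ := fun x => -(x / (2 * r ^ 2)) with hD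
  have hφD (x : ℝ) : HasDerivAt φ (D x) x := by
    have h := (((hasDerivAt_id x).div_const (2 * r)).pow 2).const_sub 1
    refine h.congr_deriv ?_
    simp only [hD, id, Nat.add_one_sub_one, pow_one]
    push_cast
    field_simp
  have hw (x : ℝ) : HasDerivAt (fun x : ℝ => Real.exp (-x ^ 2))
      (Real.exp (-x ^ 2) * (-(2 * x))) x := by
    simpa using ((hasDerivAt_id x).pow 2).neg.exp
  have hP (x : ℝ) : HasDerivAt (fun x => φ x ^ 2 * (y x * deriv y x * Real.exp (-x ^ 2)))
      ((2 * φ x * D x * y x * deriv y x + φ x ^ 2 * deriv y x ^ 2 - lam * φ x ^ 2 * y x ^ 2)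
        * Real.exp (-x ^ 2)) x := by
    refine (((hφD x).pow 2).mul
      (((hy x).hasDerivAt.mul (hy' x).hasDerivAt).mul (hw x))).congr_deriv ?_
    simp only [Pi.mul_apply, Pi.pow_apply]
    linear_combination (φ x ^ 2 * y x * Real.exp (-x ^ 2)) * heq x
  have hφc : Continuous φ := by fun_prop
  have hDc : Continuous D := by fun_prop
  have hzero : ∫ x in (-(2 * r))..(2 * r),
      (2 * φ x * D x * y x * deriv y x + φ x ^ 2 * deriv y x ^ 2 - lam * φ x ^ 2 * y x ^ 2)
        * Real.exp (-x ^ 2) = 0 := by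
    rw [intervalIntegral.integral_eq_sub_of_hasDerivAt (fun x _ => hP x)
      (Continuous.intervalIntegrable (by fun_prop) _ _)]
    have h1 : φ (2 * r) = 0 := by simp only [hφ]; field_simp; ring
    have h2 : φ (-(2 * r)) = 0 := by simp only [hφ]; field_simp; ring
    rw [h1, h2]; ring
  have hDsq (x : ℝ) (hx : x ∈ Set.Icc (-(2 * r)) (2 * r)) : D x ^ 2 ≤ 1 / r ^ 2 := by
    have : x ^ 2 ≤ (2 * r) ^ 2 := sq_le_sq' hx.1 hx.2
    simp only [hD]
    rw [neg_sq, div_pow, div_le_div_iff₀ (by positivity) (by positivity)]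
    nlinarith [mul_le_mul_of_nonneg_right this (sq_nonneg r)]
  have hφle (x : ℝ) (hx : x ∈ Set.Icc (-(2 * r)) (2 * r)) : φ x ^ 2 ≤ 1 := by
    have h2 : (x / (2 * r)) ^ 2 ≤ 1 := by
      rw [div_pow, div_le_one (by positivity)]
      exact sq_le_sq' hx.1 hx.2
    have h3 := sq_nonneg (x / (2 * r))
    simp only [hφ]
    nlinarith
  have hφge (x : ℝ) (hx : x ∈ Set.Icc (-r) r) : 1 / 2 ≤ φ x ^ 2 := by
    have h2 : (x / (2 * r)) ^ 2 ≤ 1 / 4 := by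
      rw [div_pow, div_le_div_iff₀ (by positivity) (by positivity)]
      nlinarith [sq_le_sq' hx.1 hx.2]
    simp only [hφ]
    nlinarith
  set C : ℝ := 2 / r ^ 2 + max lam 0 with hC
  have hC0 : 0 ≤ C := add_nonneg (by positivity) (le_max_right _ _)
  have hcut : ∫ x in (-(2 * r))..(2 * r), φ x ^ 2 * deriv y x ^ 2 * Real.exp (-x ^ 2) ≤
      ∫ x in (-(2 * r))..(2 * r), 2 * C * (y x ^ 2 * Real.exp (-x ^ 2)) := by
    have key : ∫ x in (-(2 * r))..(2 * r), (φ x ^ 2 * deriv y x ^ 2 * Real.exp (-x ^ 2)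
          - 2 * ((2 * φ x * D x * y x * deriv y x + φ x ^ 2 * deriv y x ^ 2
            - lam * φ x ^ 2 * y x ^ 2) * Real.exp (-x ^ 2))) ≤
        ∫ x in (-(2 * r))..(2 * r), 2 * C * (y x ^ 2 * Real.exp (-x ^ 2)) := by
      refine intervalIntegral.integral_mono_on (by linarith)
        (Continuous.intervalIntegrable (by fun_prop) _ _)
        (Continuous.intervalIntegrable (by fun_prop) _ _) fun x hx => ?_
      have hlam : lam * φ x ^ 2 ≤ max lam 0 :=
        (mul_le_mul_of_nonneg_right (le_max_left lam 0) (sq_nonneg _)).trans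
          (mul_le_of_le_one_right (le_max_right _ _) (hφle x hx))
      have hcoef : 2 * D x ^ 2 + lam * φ x ^ 2 ≤ C := by
        have := hDsq x hx
        have h2 : 2 / r ^ 2 = 2 * (1 / r ^ 2) := by ring
        rw [hC, h2]; linarith
      have hb := mul_le_mul_of_nonneg_right hcoef (sq_nonneg (y x))
      have hE := (Real.exp_pos (-x ^ 2)).le
      have hmain : φ x ^ 2 * deriv y x ^ 2 - 2 * (2 * φ x * D x * y x * deriv y x
          + φ x ^ 2 * deriv y x ^ 2 - lam * φ x ^ 2 * y x ^ 2) ≤ 2 * C * y x ^ 2 := by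
        nlinarith [sq_nonneg (φ x * deriv y x + 2 * D x * y x)]
      linarith [mul_le_mul_of_nonneg_right hmain hE]
    rwa [intervalIntegral.integral_sub (Continuous.intervalIntegrable (by fun_prop) _ _)
      (Continuous.intervalIntegrable (by fun_prop) _ _), intervalIntegral.integral_const_mul, hzero,
      mul_zero, sub_zero] at key
  have hinner : ∫ x in (-r)..r, deriv y x ^ 2 * Real.exp (-x ^ 2) ≤
      ∫ x in (-r)..r, 2 * (φ x ^ 2 * deriv y x ^ 2 * Real.exp (-x ^ 2)) := by
    refine intervalIntegral.integral_mono_on (by linarith)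
      (Continuous.intervalIntegrable (by fun_prop) _ _)
      (Continuous.intervalIntegrable (by fun_prop) _ _) fun x hx => ?_
    have hE : 0 ≤ deriv y x ^ 2 * Real.exp (-x ^ 2) := by positivity
    nlinarith [mul_le_mul_of_nonneg_right (hφge x hx) hE]
  have houter : ∫ x in (-r)..r, φ x ^ 2 * deriv y x ^ 2 * Real.exp (-x ^ 2) ≤
      ∫ x in (-(2 * r))..(2 * r), φ x ^ 2 * deriv y x ^ 2 * Real.exp (-x ^ 2) :=
    intervalIntegral.integral_mono_interval (by linarith) (by linarith) (by linarith)
      (Eventually.of_forall fun x => by positivity)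
      (Continuous.intervalIntegrable (by fun_prop) _ _)
  have hwhole : ∫ x in (-(2 * r))..(2 * r), y x ^ 2 * Real.exp (-x ^ 2) ≤
      ∫ x, y x ^ 2 * Real.exp (-x ^ 2) := by
    rw [intervalIntegral.integral_of_le (by linarith)]
    exact setIntegral_le_integral hint (Eventually.of_forall fun x => by positivity)
  rw [intervalIntegral.integral_const_mul] at hinner hcut
  nlinarith [mul_le_mul_of_nonneg_left hwhole hC0]

/-- The derivative of a weighted square-integrable solution of the Hermite equation is weighted
square-integrable, with energy at most proportional to the positive part of the eigenvalue. -/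
theorem hermite_ode_integrable_deriv_sq {lam : ℝ} {y : ℝ → ℝ}
    (hy : Differentiable ℝ y) (hy' : Differentiable ℝ (deriv y))
    (heq : ∀ x, deriv (deriv y) x - 2 * x * deriv y x + lam * y x = 0)
    (hint : Integrable (fun x => (y x) ^ 2 * Real.exp (-x ^ 2))) :
    Integrable (fun x => (deriv y x) ^ 2 * Real.exp (-x ^ 2)) ∧
      ∫ x, (deriv y x) ^ 2 * Real.exp (-x ^ 2) ≤
        4 * max lam 0 * ∫ x, (y x) ^ 2 * Real.exp (-x ^ 2) := by
  set A := ∫ x, (y x) ^ 2 * Real.exp (-x ^ 2)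
  have hA0 : 0 ≤ A := integral_nonneg fun x => by positivity
  have hc : Continuous fun x => (deriv y x) ^ 2 * Real.exp (-x ^ 2) := by
    have := hy'.continuous
    fun_prop
  have hlim : Tendsto (fun r : ℝ => 4 * (2 / r ^ 2 + max lam 0) * A) atTop
      (𝓝 (4 * max lam 0 * A)) := by
    have h : Tendsto (fun r : ℝ => 2 / r ^ 2) atTop (𝓝 0) :=
      tendsto_const_nhds.div_atTop (tendsto_pow_atTop two_ne_zero)
    simpa using ((h.add_const (max lam 0)).const_mul 4).mul_const A
  have hbound : ∀ᶠ r : ℝ in atTop, ∫ x in (-r)..r, (deriv y x) ^ 2 * Real.exp (-x ^ 2) ≤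
      4 * (2 / r ^ 2 + max lam 0) * A := by
    filter_upwards [eventually_gt_atTop 0] with r hr
    exact hermite_ode_intervalIntegral_deriv_sq_le hy hy' heq hint hr
  have hI : Integrable (fun x => (deriv y x) ^ 2 * Real.exp (-x ^ 2)) := by
    refine integrable_of_intervalIntegral_norm_bounded (l := atTop) (a := fun r : ℝ => -r)
      (b := fun r : ℝ => r) (4 * max lam 0 * A + 1) (fun r => hc.integrableOn_Ioc)
      tendsto_neg_atTop_atBot tendsto_id ?_
    filter_upwards [hbound, hlim.eventually (gt_mem_nhds (lt_add_one _))] with r h1 h2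
    have (x : ℝ) : ‖(deriv y x) ^ 2 * Real.exp (-x ^ 2)‖ = (deriv y x) ^ 2 * Real.exp (-x ^ 2) :=
      Real.norm_of_nonneg (by positivity)
    simp_rw [this]
    linarith
  exact ⟨hI, le_of_tendsto_of_tendsto
    (intervalIntegral_tendsto_integral hI tendsto_neg_atTop_atBot tendsto_id) hlim hbound⟩

/-- The Hermite equation has no nontrivial weighted square-integrable solution for a negative
eigenvalue. -/
theorem hermite_ode_eq_zero_of_neg {lam : ℝ} {y : ℝ → ℝ} (hlam : lam < 0)
    (hy : Differentiable ℝ y) (hy' : Differentiable ℝ (deriv y))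
    (heq : ∀ x, deriv (deriv y) x - 2 * x * deriv y x + lam * y x = 0)
    (hint : Integrable (fun x => (y x) ^ 2 * Real.exp (-x ^ 2))) (x : ℝ) : y x = 0 := by
  obtain ⟨hI, hle⟩ := hermite_ode_integrable_deriv_sq hy hy' heq hint
  rw [max_eq_right hlam.le, mul_zero, zero_mul] at hle
  have hnn : 0 ≤ fun x => (deriv y x) ^ 2 * Real.exp (-x ^ 2) := fun x => by positivity
  have hae := (integral_eq_zero_iff_of_nonneg hnn hI).1 (hle.antisymm (integral_nonneg hnn))
  have hc : Continuous fun x => (deriv y x) ^ 2 * Real.exp (-x ^ 2) := by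
    have := hy'.continuous
    fun_prop
  have hz : deriv y = 0 := by
    funext t
    have ht : (deriv y t) ^ 2 * Real.exp (-t ^ 2) = 0 :=
      congrFun ((hc.ae_eq_iff_eq volume continuous_const).1 hae) t
    simpa [Real.exp_ne_zero] using ht
  have h := heq x
  simp only [hz, Pi.zero_apply, mul_zero, sub_zero] at h
  have h0 : deriv (0 : ℝ → ℝ) x = 0 := by simp
  rw [h0, zero_add] at h
  exact (mul_eq_zero.1 h).resolve_left hlam.ne

/-- the Hermite polynomials are precisely the nontrivial solutions of the Hermite
differential equation `y'' − 2x·y' + λ·y = 0` that are square-integrable with respect to the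
weight `e^{−x²}` on `ℝ`: any such solution has `λ = 2n` and `y = c·H_n` for a nonzero `c`. -/
theorem hermite_eq_sturm_liouville_solutions
    (lam : ℝ) (y : ℝ → ℝ)
    (hy : Differentiable ℝ y) (hy' : Differentiable ℝ (deriv y))
    (hy0 : ∃ x, y x ≠ 0)
    (heq : ∀ x, deriv (deriv y) x - 2 * x * deriv y x + lam * y x = 0)
    (hint : MeasureTheory.Integrable (fun x => (y x) ^ 2 * Real.exp (-x ^ 2))) :
    ∃ n : ℕ, lam = 2 * (n : ℝ) ∧
      ∃ c : ℝ, c ≠ 0 ∧ ∀ x, y x = c * (hermitePoly n).eval x := by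
  obtain ⟨N, hN⟩ := exists_nat_gt (lam / 2)
  replace hN : lam < 2 * N := by linarith
  induction N generalizing lam y with
  | zero =>
    obtain ⟨x, hx⟩ := hy0
    exact absurd (hermite_ode_eq_zero_of_neg (by simpa using hN) hy hy' heq hint x) hx
  | succ N ih =>
    have hdd : deriv (deriv y) = fun x => 2 * x * deriv y x - lam * y x := by
      funext x
      linear_combination heq x
    by_cases hz : ∃ x, deriv y x ≠ 0
    · have hddd (x : ℝ) : HasDerivAt (deriv (deriv y))
          (2 * deriv y x + 2 * x * deriv (deriv y) x - lam * deriv y x) x := by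
        nth_rw 1 [hdd]
        exact ((((hasDerivAt_id x).const_mul 2).mul (hy' x).hasDerivAt).sub
          ((hy x).hasDerivAt.const_mul lam)).congr_deriv (by simp)
      obtain ⟨m, hm, c, hc, hyc⟩ := ih (lam - 2) (deriv y) hy'
        (fun x => (hddd x).differentiableAt) hz
        (fun x => by rw [(hddd x).deriv]; ring)
        (hermite_ode_integrable_deriv_sq hy hy' heq hint).1
        (by push_cast at hN; linarith)
      have hlam : lam = 2 * ((m + 1 : ℕ) : ℝ) := by push_cast; linarith
      have hlam0 : lam ≠ 0 := by rw [hlam]; positivity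
      refine ⟨m + 1, hlam, c / lam, div_ne_zero hc hlam0, fun x => ?_⟩
      have hd : deriv (deriv y) x = c * (derivative (hermitePoly m)).eval x := by
        rw [funext hyc]
        exact (((hermitePoly m).hasDerivAt x).const_mul c).deriv
      have h := heq x
      rw [hd, hyc x] at h
      simp only [hermitePoly, eval_sub, eval_mul, eval_ofNat, eval_X]
      field_simp
      linear_combination h
    · push Not at hz
      have hconst (x : ℝ) : y x = y 0 := is_const_of_deriv_eq_zero hy hz x 0
      obtain ⟨x, hx⟩ := hy0
      have hlam : lam = 0 := by
        have h := congrFun hdd x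
        rw [funext hz] at h
        simpa [hx] using h
      exact ⟨0, by simp [hlam], y 0, hconst x ▸ hx, fun t => by simp [hermitePoly, hconst t]⟩
end

section
/- (Bochner, first part.) Let p, q, r : ℝ → ℝ be functions and suppose that for every k ∈ ℕ there exist a polynomial y_k ∈ ℝ[X] with deg y_k = k and a constant λ_k ∈ ℝ such that p(x)·y_k''(x) + q(x)·y_k'(x) + r(x)·y_k(x) = −λ_k·y_k(x) for all x ∈ ℝ. Then r is a constant function, q coincides on ℝ with the evaluation of a polynomial of degree ≤ 1, and p coincides on ℝ with the evaluation of a polynomial of degree ≤ 2. -/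
open Polynomial

/-- Bochner, first part: if `T[y] = p·y'' + q·y' + r·y` admits an eigenpolynomial
of every degree, then `r` is constant, `q` is (the evaluation of) a polynomial of degree ≤ 1,
and `p` is a polynomial of degree ≤ 2. -/
theorem bochner_coefficients_are_polynomials
    (p q r : ℝ → ℝ)
    (h : ∀ k : ℕ, ∃ y : Polynomial ℝ, y.degree = (k : ℕ) ∧ ∃ lam : ℝ,
      ∀ x : ℝ, p x * (derivative (derivative y)).eval x + q x * (derivative y).eval x
          + r x * y.eval x = -lam * y.eval x) :
    (∃ c : ℝ, ∀ x, r x = c) ∧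
    (∃ Q : Polynomial ℝ, Q.degree ≤ 1 ∧ ∀ x, q x = Q.eval x) ∧
    (∃ P : Polynomial ℝ, P.degree ≤ 2 ∧ ∀ x, p x = P.eval x) := by
  obtain ⟨y₀, hy₀, l₀, h₀⟩ := h 0
  obtain ⟨y₁, hy₁, l₁, h₁⟩ := h 1
  obtain ⟨y₂, hy₂, l₂, h₂⟩ := h 2
  have hc₀ : y₀.coeff 0 ≠ 0 := coeff_ne_zero_of_eq_degree hy₀
  have hc₁ : y₁.coeff 1 ≠ 0 := coeff_ne_zero_of_eq_degree hy₁
  have hc₂ : y₂.coeff 2 ≠ 0 := coeff_ne_zero_of_eq_degree hy₂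
  have e₀ := eq_C_of_degree_le_zero (p := y₀) (by simp [hy₀])
  have e₁ := eq_X_add_C_of_degree_le_one (p := y₁) (by simp [hy₁])
  have e₂ := eq_quadratic_of_degree_le_two (p := y₂) (by simp [hy₂])
  generalize y₀.coeff 0 = a at *
  generalize y₁.coeff 1 = b₁ at *
  generalize y₁.coeff 0 = b₀ at *
  generalize y₂.coeff 2 = c₂ at *
  generalize y₂.coeff 1 = c₁ at *
  generalize y₂.coeff 0 = c₀ at *
  subst e₀ e₁ e₂
  have hr : ∀ x, r x = -l₀ := fun x => by simpa [hc₀, ← neg_mul] using h₀ x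
  have hq : ∀ x, q x = (l₀ - l₁) * (x + b₀ / b₁) := fun x => by
    have := h₁ x
    simp only [derivative_add, derivative_mul, derivative_C, derivative_X, eval_add, eval_mul,
      eval_C, eval_X, eval_zero, eval_one, derivative_zero, derivative_one, hr] at this
    field_simp
    linear_combination this
  refine ⟨⟨-l₀, hr⟩, ⟨C (l₀ - l₁) * (X + C (b₀ / b₁)), by compute_degree, fun x => by simp [hq]⟩,
    ⟨C (2 * c₂)⁻¹ * (C (l₀ - l₂) * (C c₂ * X ^ 2 + C c₁ * X + C c₀) -
      C (l₀ - l₁) * (X + C (b₀ / b₁)) * (C (2 * c₂) * X + C c₁)), by compute_degree, fun x => ?_⟩⟩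
  have := h₂ x
  simp only [derivative_add, derivative_mul, derivative_C, derivative_X, derivative_X_pow,
    eval_add, eval_mul, eval_C, eval_X, eval_pow, eval_zero, eval_one, derivative_zero,
    derivative_one, hr, hq] at this
  simp only [eval_add, eval_mul, eval_sub, eval_C, eval_X, eval_pow]
  norm_num at this
  rw [eq_inv_mul_iff_mul_eq₀ (by simpa using hc₂)]
  linear_combination this
end

section
/- For every natural number n ≥ 4, the following identity of polynomials in ℝ[X] holds: Wr[H_1, H_2, H_n] = 8(n−1)(n−2)·( H_n + 4n·H_{n−2} + 4n(n−3)·H_{n−4} ), where Wr[H_1, H_2, H_n] is the 3×3 Wronskian determinant of the physicists' Hermite polynomials H_1, H_2, H_n. -/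
open Polynomial

/-- The Wronskian of `m` polynomials: the determinant of the `m × m` matrix whose `(i, j)` entry
is the `j`-th derivative of `p i`. -/
noncomputable def polyWronskian {m : ℕ} (p : Fin m → Polynomial ℝ) : Polynomial ℝ :=
  Matrix.det (Matrix.of fun i j : Fin m => (⇑(derivative (R := ℝ)))^[(j : ℕ)] (p i))

/-- The derivative of a Hermite polynomial: `(H_{n+1})' = 2(n+1)·H_n`. -/
theorem derivative_hermitePoly_succ (n : ℕ) :
    derivative (hermitePoly (n + 1)) = 2 * ((n : ℝ[X]) + 1) * hermitePoly n := by
  induction n with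
  | zero => simp [hermitePoly]
  | succ k ih =>
    have h2 : derivative (2 : ℝ[X]) = 0 := derivative_ofNat 2
    have hk : derivative (2 * ((k : ℝ[X]) + 1)) = 0 := by simp [derivative_mul, h2]
    rw [hermitePoly, ih, derivative_sub, derivative_mul, derivative_mul, ih,
      derivative_mul (f := 2 * ((k : ℝ[X]) + 1)), hk, h2, derivative_X, hermitePoly]
    push_cast
    ring

/-- The three-term recurrence `H_{n+2} = 2·X·H_{n+1} − 2(n+1)·H_n`. -/
theorem hermitePoly_add_two (n : ℕ) :
    hermitePoly (n + 2) = 2 * X * hermitePoly (n + 1) - 2 * ((n : ℝ[X]) + 1) * hermitePoly n := by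
  rw [hermitePoly, derivative_hermitePoly_succ]

/-- The second derivative `(H_{n+2})'' = 4(n+2)(n+1)·H_n`. -/
theorem derivative_derivative_hermitePoly_add_two (n : ℕ) :
    derivative (derivative (hermitePoly (n + 2)))
      = 4 * ((n : ℝ[X]) + 2) * ((n : ℝ[X]) + 1) * hermitePoly n := by
  have hc : derivative (2 * (((n + 1 : ℕ) : ℝ[X]) + 1)) = 0 := by simp [derivative_mul]
  rw [derivative_hermitePoly_succ, derivative_mul, hc, derivative_hermitePoly_succ]
  push_cast
  ring

/-- The Wronskian of `H₁`, `H₂` and `p` as a second-order differential operator applied to `p`. -/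
theorem polyWronskian_hermitePoly_one_two (p : ℝ[X]) :
    polyWronskian ![hermitePoly 1, hermitePoly 2, p]
      = (8 * X ^ 2 + 4) * derivative (derivative p) - 16 * X * derivative p + 16 * p := by
  have h1 : hermitePoly 1 = 2 * X := by simp [hermitePoly]
  have h2 : hermitePoly 2 = 4 * X ^ 2 - 2 := by
    rw [hermitePoly_add_two, h1]
    simp only [hermitePoly, Nat.cast_zero]
    ring
  rw [polyWronskian, Matrix.det_fin_three, h1, h2]
  simp [derivative_mul]
  ring

/-- for `n ≥ 4`,
`Wr[H₁, H₂, H_n] = 8(n−1)(n−2)·(H_n + 4n·H_{n−2} + 4n(n−3)·H_{n−4})`. -/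
theorem wronskian_H1_H2_Hn (n : ℕ) (hn : 4 ≤ n) :
    polyWronskian ![hermitePoly 1, hermitePoly 2, hermitePoly n]
      = C (8 * ((n : ℝ) - 1) * ((n : ℝ) - 2)) *
          (hermitePoly n + C (4 * (n : ℝ)) * hermitePoly (n - 2)
            + C (4 * (n : ℝ) * ((n : ℝ) - 3)) * hermitePoly (n - 4)) := by
  obtain ⟨m, rfl⟩ := Nat.exists_eq_add_of_le' hn
  rw [polyWronskian_hermitePoly_one_two, derivative_derivative_hermitePoly_add_two,
    derivative_hermitePoly_succ, Nat.add_sub_cancel, show m + 4 - 2 = m + 2 by omega,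
    hermitePoly_add_two (m + 2), hermitePoly_add_two (m + 1), hermitePoly_add_two m]
  push_cast
  simp only [map_mul, map_sub, map_add, map_natCast, map_ofNat, map_one]
  ring
end

section
/- For every natural number n ≥ 7, the exceptional Hermite polynomials Ĥ_k := H_k + 4k·H_{k−2} + 4k(k−3)·H_{k−4} satisfy the higher-order recurrence relation 4X(3 + 2X²)·Ĥ_n = Ĥ_{n+3} + 6n·Ĥ_{n+1} + 12n(n−3)·Ĥ_{n−1} + 8n(n−4)(n−5)·Ĥ_{n−3} as an identity in ℝ[X]. -/
open Polynomial

/-- The exceptional Hermite polynomials of codimension 2: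
`Ĥ_k = H_k + 4k·H_{k−2} + 4k(k−3)·H_{k−4}`. -/
noncomputable def excHermitePoly (k : ℕ) : Polynomial ℝ :=
  hermitePoly k + C (4 * (k : ℝ)) * hermitePoly (k - 2)
    + C (4 * (k : ℝ) * ((k : ℝ) - 3)) * hermitePoly (k - 4)

/-- for `n ≥ 7`, the exceptional Hermite polynomials satisfy
`4X(3 + 2X²)·Ĥ_n = Ĥ_{n+3} + 6n·Ĥ_{n+1} + 12n(n−3)·Ĥ_{n−1} + 8n(n−4)(n−5)·Ĥ_{n−3}`. -/
theorem excHermite_recurrence_order3 (n : ℕ) (hn : 7 ≤ n) :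
    4 * X * (3 + 2 * X ^ 2) * excHermitePoly n
      = excHermitePoly (n + 3) + C (6 * (n : ℝ)) * excHermitePoly (n + 1)
        + C (12 * (n : ℝ) * ((n : ℝ) - 3)) * excHermitePoly (n - 1)
        + C (8 * (n : ℝ) * ((n : ℝ) - 4) * ((n : ℝ) - 5)) * excHermitePoly (n - 3) := by
  obtain ⟨m, rfl⟩ := Nat.exists_eq_add_of_le' hn
  simp only [excHermitePoly, show m + 7 - 1 = m + 6 by lia, show m + 7 - 3 = m + 4 by lia,
    show m + 7 - 2 = m + 5 by lia, show m + 7 - 4 = m + 3 by lia,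
    show m + 7 + 3 - 2 = m + 8 by lia, show m + 7 + 3 - 4 = m + 6 by lia,
    show m + 7 + 1 - 2 = m + 6 by lia, show m + 7 + 1 - 4 = m + 4 by lia,
    show m + 6 - 2 = m + 4 by lia, show m + 6 - 4 = m + 2 by lia,
    show m + 4 - 2 = m + 2 by lia, show m + 4 - 4 = m by lia,
    show m + 7 + 3 = m + 10 by lia, show m + 7 + 1 = m + 8 by lia]
  simp only [hermitePoly_add_two, map_mul, map_sub, map_natCast, map_ofNat]
  push_cast
  ring
end

section
/- Define the operators on ℝ[X]: T[y] := y'' − 2X·y' and A[y] := 4(1 + 2X²)·y'' − 16X·y' + 16·y. Then for every polynomial y ∈ ℝ[X] the following intertwining identity (the relation T̂∘A = A∘T cleared of denominators) holds in ℝ[X]: (1 + 2X²)·(A[y])'' − ( 2X(1 + 2X²) + 8X )·(A[y])' = (1 + 2X²)·A[T[y]]. -/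
open Polynomial

/-- The classical Hermite operator `T[y] = y'' − 2X·y'`. -/
noncomputable def hermiteOp (y : Polynomial ℝ) : Polynomial ℝ :=
  derivative (derivative y) - 2 * X * derivative y

/-- The second-order intertwiner `A[y] = 4(1 + 2X²)·y'' − 16X·y' + 16·y`. -/
noncomputable def intertwinerOp (y : Polynomial ℝ) : Polynomial ℝ :=
  4 * (1 + 2 * X ^ 2) * derivative (derivative y) - 16 * X * derivative y + 16 * y

/-- the intertwining relation `T̂ ∘ A = A ∘ T` cleared of denominators:
`(1 + 2X²)·(A[y])'' − (2X(1 + 2X²) + 8X)·(A[y])' = (1 + 2X²)·A[T[y]]` for all `y ∈ ℝ[X]`. -/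
theorem hermite_intertwining_relation (y : Polynomial ℝ) :
    (1 + 2 * X ^ 2) * derivative (derivative (intertwinerOp y))
        - (2 * X * (1 + 2 * X ^ 2) + 8 * X) * derivative (intertwinerOp y)
      = (1 + 2 * X ^ 2) * intertwinerOp (hermiteOp y) := by
  simp only [intertwinerOp, hermiteOp, derivative_add, derivative_sub, derivative_mul,
    derivative_X, derivative_X_sq, derivative_ofNat, derivative_one, derivative_zero,
    map_ofNat]
  ring
end

section
/- Let f_0, f_1, f_2 : ℝ → ℝ with f_0 twice differentiable and nowhere vanishing and f_1, f_2 differentiable, and let α_0, α_1, α_2 ∈ ℝ. Suppose the symmetric P_IV system holds pointwise on ℝ: f_0' + f_0·(f_1 − f_2) = α_0, f_1' + f_1·(f_2 − f_0) = α_1, f_2' + f_2·(f_0 − f_1) = α_2, together with the normalization f_0(z) + f_1(z) + f_2(z) = z for all z. Then f_0 satisfies the fourth Painlevé equation in the form f_0'' = (f_0')²/(2f_0) + (3/2)·f_0³ − 2z·f_0² + ( z²/2 + α_2 − α_1 )·f_0 − α_0²/(2f_0) pointwise on ℝ. -/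
/-- a solution of the symmetric P_IV system with normalization
`f₀ + f₁ + f₂ = z` yields a solution `f₀` of the fourth Painlevé equation
`f₀'' = (f₀')²/(2f₀) + (3/2)f₀³ − 2z·f₀² + (z²/2 + α₂ − α₁)f₀ − α₀²/(2f₀)`. -/
theorem symmetric_PIV_reduces_to_PIV
    (f0 f1 f2 : ℝ → ℝ) (α0 α1 α2 : ℝ)
    (hf0 : Differentiable ℝ f0) (hf0' : Differentiable ℝ (deriv f0))
    (hf00 : ∀ z, f0 z ≠ 0)
    (hf1 : Differentiable ℝ f1) (hf2 : Differentiable ℝ f2)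
    (e0 : ∀ z, deriv f0 z + f0 z * (f1 z - f2 z) = α0)
    (e1 : ∀ z, deriv f1 z + f1 z * (f2 z - f0 z) = α1)
    (e2 : ∀ z, deriv f2 z + f2 z * (f0 z - f1 z) = α2)
    (hnorm : ∀ z, f0 z + f1 z + f2 z = z) :
    ∀ z, deriv (deriv f0) z
        = (deriv f0 z) ^ 2 / (2 * f0 z) + (3 / 2) * (f0 z) ^ 3 - 2 * z * (f0 z) ^ 2
          + (z ^ 2 / 2 + α2 - α1) * f0 z - α0 ^ 2 / (2 * f0 z) := by
  intro z
  have deriv_f0 : deriv f0 = fun x => α0 - f0 x * (f1 x - f2 x) :=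
    funext fun x => eq_sub_of_add_eq (e0 x)
  have deriv_deriv_f0 : deriv (deriv f0) z =
      -(deriv f0 z * (f1 z - f2 z) + f0 z * (deriv f1 z - deriv f2 z)) := by
    have h := ((hf0 z).hasDerivAt.mul
      ((hf1 z).hasDerivAt.sub (hf2 z).hasDerivAt)).const_sub α0
    exact (congrArg (fun g => deriv g z) deriv_f0).trans h.deriv
  rw [deriv_deriv_f0, eq_sub_of_add_eq (e0 z), eq_sub_of_add_eq (e1 z), eq_sub_of_add_eq (e2 z)]
  have h0 := hf00 z
  have hz := hnorm z
  generalize f0 z = a at *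
  generalize f1 z = b at *
  generalize f2 z = c at *
  subst hz
  field_simp
  ring
end

section
/- Let n ≥ 1 and p = 2n+1, and index by i ∈ ℤ/pℤ. Let w_i : ℂ → ℂ be differentiable functions and a_i ∈ ℂ constants satisfying the p-cyclic dressing chain equations (w_i + w_{i+1})' + w_{i+1}² − w_i² = a_i pointwise on ℂ for all i ∈ ℤ/pℤ, and set Δ := −(a_0 + a_1 + ⋯ + a_{p−1}); assume Δ ≠ 0. Let c ∈ ℂ satisfy c² = −1/Δ, and define f_i(z) := c·( w_i(cz) + w_{i+1}(cz) ) and α_i := c²·a_i. Then for every i ∈ ℤ/pℤ and all z ∈ ℂ: f_i'(z) + f_i(z)·( Σ_{j=1}^{n} f_{i+2j−1}(z) − Σ_{j=1}^{n} f_{i+2j}(z) ) = α_i, and moreover α_0 + α_1 + ⋯ + α_{p−1} = 1. That is, every solution of a (2n+1)-cyclic Darboux dressing chain with nonzero shift Δ yields a solution of the A_{2n}-Painlevé (Noumi–Yamada) system with the standard normalization. -/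
/-- Sums of neighbouring terms, taken with alternating signs, telescope. -/
theorem sum_odd_sub_sum_even_shift {R A : Type*} [CommRing R] [AddCommGroup A] (u : R → A) (i : R)
    (n : ℕ) :
    (∑ j ∈ Finset.range n, (u (i + ((2 * j + 1 : ℕ) : R)) + u (i + ((2 * j + 1 : ℕ) : R) + 1)))
      - ∑ j ∈ Finset.range n, (u (i + ((2 * j + 2 : ℕ) : R)) + u (i + ((2 * j + 2 : ℕ) : R) + 1))
      = u (i + 1) - u (i + ((2 * n + 1 : ℕ) : R)) := by
  induction n with
  | zero => simp
  | succ k ih =>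
    have h₁ : i + ((2 * k + 1 : ℕ) : R) + 1 = i + ((2 * k + 2 : ℕ) : R) := by push_cast; ring
    have h₂ : i + ((2 * k + 2 : ℕ) : R) + 1 = i + ((2 * (k + 1) + 1 : ℕ) : R) := by
      push_cast; ring
    rw [Finset.sum_range_succ, Finset.sum_range_succ, add_sub_add_comm, ih, h₁, h₂]
    abel

/-- every solution of a `(2n+1)`-cyclic Darboux dressing chain with nonzero
shift `Δ` yields a solution of the `A_{2n}`-Painlevé (Noumi–Yamada) system with the standard
normalization `Σ αᵢ = 1`. -/
theorem dressing_chain_to_noumi_yamada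
    (n : ℕ) (hn : 1 ≤ n)
    (w : ZMod (2 * n + 1) → ℂ → ℂ) (a : ZMod (2 * n + 1) → ℂ)
    (hw : ∀ i, Differentiable ℂ (w i))
    (hchain : ∀ i, ∀ z : ℂ,
      deriv (fun t => w i t + w (i + 1) t) z + (w (i + 1) z) ^ 2 - (w i z) ^ 2 = a i)
    (Δ : ℂ) (hΔdef : Δ = -(∑ j ∈ Finset.range (2 * n + 1), a ((j : ℕ) : ZMod (2 * n + 1))))
    (hΔ : Δ ≠ 0)
    (c : ℂ) (hc : c ^ 2 = -1 / Δ)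
    (f : ZMod (2 * n + 1) → ℂ → ℂ)
    (hf : ∀ i z, f i z = c * (w i (c * z) + w (i + 1) (c * z)))
    (α : ZMod (2 * n + 1) → ℂ) (hα : ∀ i, α i = c ^ 2 * a i) :
    (∀ i, ∀ z : ℂ,
      deriv (f i) z + f i z *
          ((∑ j ∈ Finset.range n, f (i + ((2 * j + 1 : ℕ) : ZMod (2 * n + 1))) z)
            - ∑ j ∈ Finset.range n, f (i + ((2 * j + 2 : ℕ) : ZMod (2 * n + 1))) z)
        = α i) ∧
    ∑ j ∈ Finset.range (2 * n + 1), α ((j : ℕ) : ZMod (2 * n + 1)) = 1 := by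
  refine ⟨fun i z => ?_, ?_⟩
  · have hderiv : deriv (f i) z = c ^ 2 * deriv (fun t => w i t + w (i + 1) t) (c * z) := by
      rw [funext (hf i), deriv_const_mul_field,
        deriv_comp_mul_left c (fun t => w i t + w (i + 1) t) z, smul_eq_mul]
      ring
    have hsum := sum_odd_sub_sum_even_shift (fun k => w k (c * z)) i n
    rw [ZMod.natCast_self, add_zero] at hsum
    simp only [hf i z, hf (i + _) z]
    rw [← Finset.mul_sum, ← Finset.mul_sum, ← mul_sub, hsum, hderiv, hα, ← hchain i (c * z)]
    ring
  · simp only [hα]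
    rw [← Finset.mul_sum, hc, ← neg_eq_iff_eq_neg.mpr hΔdef]
    field_simp
end

section
/- Let g ∈ ℕ and let β_0 < β_1 < ⋯ < β_{2g} be integers, and define the Maya diagram in block coordinates M := Ξ(β) = {m ∈ ℤ : m < β_0} ∪ ⋃_{i=0}^{g−1} {m ∈ ℤ : β_{2i+1} ≤ m < β_{2i+2}}. Then the symmetric difference of M and M+1 is exactly the set of block coordinates: Υ(M, M+1) = (M \ (M+1)) ∪ ((M+1) \ M) = {β_0, β_1, …, β_{2g}}. In particular, the multi-flip at the sites β_0, …, β_{2g} maps M to M + 1. -/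
/-- Membership in the Maya diagram with block coordinates `b 0, …, b (2 * g)`. -/
def MayaBlockMem (b : ℕ → ℤ) (g : ℕ) (m : ℤ) : Prop :=
  m < b 0 ∨ ∃ i < g, b (2 * i + 1) ≤ m ∧ m < b (2 * i + 2)

theorem mayaBlockMem_succ (b : ℕ → ℤ) (g : ℕ) (m : ℤ) :
    MayaBlockMem b (g + 1) m ↔
      MayaBlockMem b g m ∨ (b (2 * g + 1) ≤ m ∧ m < b (2 * g + 2)) := by
  unfold MayaBlockMem
  rw [Nat.exists_lt_succ_right, or_assoc]

theorem MayaBlockMem.lt {b : ℕ → ℤ} {g : ℕ} (hb : ∀ j < 2 * g, b j < b (j + 1)) {m : ℤ}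
    (hm : MayaBlockMem b g m) : m < b (2 * g) := by
  induction g with
  | zero => simpa [MayaBlockMem] using hm
  | succ g ih =>
    have h₀ := hb (2 * g) (by omega)
    have h₁ : b (2 * g + 1) < b (2 * g + 2) := hb (2 * g + 1) (by omega)
    rw [show 2 * (g + 1) = 2 * g + 2 by ring]
    rcases (mayaBlockMem_succ b g m).1 hm with h | h
    · have := ih (fun j hj => hb j (by omega)) h
      omega
    · exact h.2

/-- Membership changes between `m - 1` and `m` exactly at the block coordinates. -/
theorem not_mayaBlockMem_iff_sub_one {b : ℕ → ℤ} {g : ℕ}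
    (hb : ∀ j < 2 * g, b j < b (j + 1)) (m : ℤ) :
    ¬ (MayaBlockMem b g m ↔ MayaBlockMem b g (m - 1)) ↔ ∃ j < 2 * g + 1, b j = m := by
  induction g with
  | zero =>
    simp only [MayaBlockMem, Nat.not_lt_zero, false_and, exists_false, or_false]
    simp
    omega
  | succ g ih =>
    have hb' : ∀ j < 2 * g, b j < b (j + 1) := fun j hj => hb j (by omega)
    have h₀ := hb (2 * g) (by omega)
    have h₁ : b (2 * g + 1) < b (2 * g + 2) := hb (2 * g + 1) (by omega)
    have hm : MayaBlockMem b g m → m < b (2 * g) := MayaBlockMem.lt hb'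
    have hm' : MayaBlockMem b g (m - 1) → m - 1 < b (2 * g) := MayaBlockMem.lt hb'
    have ih' := ih hb'
    rw [show 2 * (g + 1) + 1 = 2 * g + 1 + 1 + 1 by ring, Nat.exists_lt_succ_right,
      Nat.exists_lt_succ_right, ← ih', mayaBlockMem_succ, mayaBlockMem_succ]
    by_cases p : MayaBlockMem b g m <;> by_cases q : MayaBlockMem b g (m - 1) <;>
      simp only [p, q, true_implies] at hm hm' ⊢ <;> simp <;> omega

/-- for the Maya diagram `M = Ξ(β)` in block coordinates
`β₀ < β₁ < ⋯ < β_{2g}`, the symmetric difference `Υ(M, M+1)` is exactly the set of block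
coordinates `{β₀, …, β_{2g}}`; in particular the multi-flip at these sites maps `M` to `M+1`. -/
theorem maya_block_coordinates_flip (g : ℕ) (β : Fin (2 * g + 1) → ℤ) (hβ : StrictMono β)
    (M : Set ℤ)
    (hM : M = {m : ℤ | m < β 0} ∪
      ⋃ i : Fin g, {m : ℤ | β ⟨2 * (i : ℕ) + 1, by have := i.isLt; omega⟩ ≤ m ∧
        m < β ⟨2 * (i : ℕ) + 2, by have := i.isLt; omega⟩})
    (M' : Set ℤ) (hM' : M' = (· + 1) '' M) :
    (M \ M') ∪ (M' \ M) = Set.range β ∧ symmDiff M (Set.range β) = M' := by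
  have hsucc : ∀ j < 2 * g, (fun n => if h : n < 2 * g + 1 then β ⟨n, h⟩ else 0) j <
      (fun n => if h : n < 2 * g + 1 then β ⟨n, h⟩ else 0) (j + 1) := by
    intro j hj
    simp only [show j < 2 * g + 1 by omega, show j + 1 < 2 * g + 1 by omega, dite_true]
    exact hβ (by simp [Fin.lt_def])
  have hval : ∀ j (h : j < 2 * g + 1),
      (fun n => if h : n < 2 * g + 1 then β ⟨n, h⟩ else 0) j = β ⟨j, h⟩ := by
    intro j h
    simp [h]
  generalize (fun n => if h : n < 2 * g + 1 then β ⟨n, h⟩ else 0) = b at hsucc hval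
  have hmem : ∀ m, m ∈ M ↔ MayaBlockMem b g m := by
    intro m
    simp only [hM, MayaBlockMem, Set.mem_union, Set.mem_ofPred_eq, Set.mem_iUnion]
    refine or_congr ?_ ⟨?_, ?_⟩
    · rw [hval 0 (by omega)]
      rfl
    · rintro ⟨i, hi⟩
      refine ⟨i, i.isLt, ?_⟩
      rwa [hval _ (by omega), hval _ (by omega)]
    · rintro ⟨i, hi, h⟩
      refine ⟨⟨i, hi⟩, ?_⟩
      rwa [hval _ (by omega), hval _ (by omega)] at h
  have hmem' : ∀ m, m ∈ M' ↔ MayaBlockMem b g (m - 1) := by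
    intro m
    rw [← hmem, hM']
    constructor
    · rintro ⟨x, hx, rfl⟩
      simpa using hx
    · exact fun h => ⟨m - 1, h, by simp⟩
  have hrange : ∀ m, m ∈ Set.range β ↔ ¬ (m ∈ M ↔ m ∈ M') := by
    intro m
    rw [hmem, hmem', not_mayaBlockMem_iff_sub_one hsucc]
    constructor
    · rintro ⟨j, rfl⟩
      exact ⟨j, j.isLt, hval _ _⟩
    · rintro ⟨j, hj, rfl⟩
      exact ⟨⟨j, hj⟩, (hval _ _).symm⟩
  constructor
  · ext m
    rw [hrange]
    simp only [Set.mem_union, Set.mem_sdiff]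
    tauto
  · ext m
    rw [Set.mem_symmDiff, hrange]
    tauto
end

section
/- Let M ⊆ ℤ be a Maya diagram and k ≥ 1 an integer. For i = 0, 1, …, k−1 define the k-modular decomposition M^(i) := {m ∈ ℤ : k·m + i ∈ M}. Then each M^(i) is a Maya diagram, each symmetric difference Υ(M^(i), M^(i)+1) is a finite set of odd cardinality p_i, the symmetric difference Υ(M, M+k) is finite, and card Υ(M, M+k) = p_0 + p_1 + ⋯ + p_{k−1}. In particular, M is (p,k)-cyclic with p = Σ_{i=0}^{k−1} (2g_i + 1), where g_i is the genus of M^(i) (so p_i = 2g_i + 1). -/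
/-- A Maya diagram: a set `M ⊆ ℤ` containing finitely many nonnegative integers and excluding
finitely many negative integers. -/
def IsMayaDiagram (M : Set ℤ) : Prop :=
  (M ∩ {m : ℤ | 0 ≤ m}).Finite ∧ {m : ℤ | m < 0 ∧ m ∉ M}.Finite

/-- The symmetric difference `Υ(A, B) = (A \ B) ∪ (B \ A)`. -/
def mayaUpsilon (A B : Set ℤ) : Set ℤ := (A \ B) ∪ (B \ A)

theorem mem_mayaUpsilon_add (M : Set ℤ) (k m : ℤ) :
    m ∈ mayaUpsilon M ((· + k) '' M) ↔ ¬(m ∈ M ↔ m - k ∈ M) := by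
  have h : m ∈ (· + k) '' M ↔ m - k ∈ M := by
    simp [sub_eq_add_neg]
  rw [mayaUpsilon, Set.mem_union, Set.mem_sdiff, Set.mem_sdiff, h]
  tauto

theorem isMayaDiagram_iff_exists_bounds (M : Set ℤ) :
    IsMayaDiagram M ↔ ∃ a b : ℤ, (∀ m < a, m ∈ M) ∧ ∀ m, b ≤ m → m ∉ M := by
  constructor
  · rintro ⟨h1, h2⟩
    obtain ⟨b, hb⟩ := h1.bddAbove
    obtain ⟨a, ha⟩ := h2.bddBelow
    refine ⟨min a 0, max (b + 1) 0, fun m hm => ?_, fun m hm hmM => ?_⟩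
    · by_contra hmM
      have := ha (show m ∈ {m : ℤ | m < 0 ∧ m ∉ M} from ⟨by omega, hmM⟩)
      omega
    · have := hb (show m ∈ M ∩ {m : ℤ | 0 ≤ m} from ⟨hmM, show 0 ≤ m by omega⟩)
      omega
  · rintro ⟨a, b, ha, hb⟩
    refine ⟨(Set.finite_Ico 0 b).subset ?_, (Set.finite_Ico a 0).subset ?_⟩
    · rintro m ⟨hm, h0⟩
      exact ⟨h0, not_le.1 fun h => hb m h hm⟩
    · rintro m ⟨h0, hm⟩
      exact ⟨not_lt.1 fun h => hm (ha m h), h0⟩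

theorem IsMayaDiagram.preimage_mul_add {M : Set ℤ} (hM : IsMayaDiagram M) {k : ℤ} (hk : 0 < k)
    (i : ℤ) : IsMayaDiagram {m : ℤ | k * m + i ∈ M} := by
  obtain ⟨a, b, ha, hb⟩ := (isMayaDiagram_iff_exists_bounds M).1 hM
  refine (isMayaDiagram_iff_exists_bounds _).2
    ⟨min (a - i) 0, max (b - i) 0, fun m hm => ha _ ?_, fun m hm => hb _ ?_⟩
  · nlinarith [min_le_left (a - i) 0, min_le_right (a - i) 0]
  · nlinarith [le_max_left (b - i) 0, le_max_right (b - i) 0]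

theorem IsMayaDiagram.finite_mayaUpsilon_add {M : Set ℤ} (hM : IsMayaDiagram M) (k : ℤ) :
    (mayaUpsilon M ((· + k) '' M)).Finite := by
  obtain ⟨a, b, ha, hb⟩ := (isMayaDiagram_iff_exists_bounds M).1 hM
  refine (Set.finite_Icc (min a (a + k)) (max b (b + k))).subset fun m hm => ?_
  rw [mem_mayaUpsilon_add] at hm
  by_contra h
  rw [Set.mem_Icc, not_and_or, not_le, not_le] at h
  rcases h with h | h
  · exact hm (iff_of_true (ha _ (by omega)) (ha _ (by omega)))
  · exact hm (iff_of_false (hb _ (by omega)) (hb _ (by omega)))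

open Classical in
/-- The number of changes of membership along `a, a + 1, …, a + n` is odd exactly when the two
endpoints differ. -/
theorem odd_card_membership_changes_iff (M : Set ℤ) (a : ℤ) (n : ℕ) :
    Odd ((Finset.range n).filter fun j : ℕ => ¬(a + j + 1 ∈ M ↔ a + j ∈ M)).card ↔
      ¬(a ∈ M ↔ a + n ∈ M) := by
  induction n with
  | zero => simp
  | succ n ih =>
    rw [Finset.range_add_one, Finset.filter_insert]
    push_cast
    rw [← add_assoc]
    split_ifs with h
    · rw [ih]
      tauto
    · rw [Finset.card_insert_of_notMem (by simp), Nat.odd_add_one, ih]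
      tauto

theorem IsMayaDiagram.odd_ncard_mayaUpsilon_add_one {M : Set ℤ} (hM : IsMayaDiagram M) :
    Odd (mayaUpsilon M ((· + 1) '' M)).ncard := by
  classical
  obtain ⟨a, b, ha, hb⟩ := (isMayaDiagram_iff_exists_bounds M).1 hM
  set n : ℕ := (b - (a - 1)).toNat with hn
  have hends : ¬(a - 1 ∈ M ↔ a - 1 + n ∈ M) := fun h =>
    hb _ (by omega) (h.1 (ha _ (by omega)))
  have himage : mayaUpsilon M ((· + 1) '' M) = (fun j : ℕ => a - 1 + j + 1) ''
      ((Finset.range n).filter fun j : ℕ => ¬(a - 1 + j + 1 ∈ M ↔ a - 1 + j ∈ M) : Finset ℕ) := by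
    ext m
    rw [mem_mayaUpsilon_add]
    simp only [Finset.coe_filter, Finset.mem_range, Set.mem_image, Set.mem_ofPred_eq]
    constructor
    · intro h
      have h1 : a ≤ m := by
        by_contra h'
        exact h (iff_of_true (ha _ (by omega)) (ha _ (by omega)))
      have h2 : m - 1 < b := by
        by_contra h'
        exact h (iff_of_false (hb _ (by omega)) (hb _ (by omega)))
      have e : a - 1 + ((m - a).toNat : ℤ) = m - 1 := by omega
      refine ⟨(m - a).toNat, ⟨by omega, ?_⟩, by omega⟩
      rwa [e, sub_add_cancel]
    · rintro ⟨j, ⟨-, h⟩, rfl⟩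
      rwa [add_sub_cancel_right]
  rw [himage, Set.ncard_image_of_injective _ fun x y h => by simpa using h, Set.ncard_coe_finset]
  exact (odd_card_membership_changes_iff M (a - 1) n).2 hends

/-- A finite set of integers is counted by its residue classes modulo `k`. -/
theorem ncard_eq_sum_ncard_preimage_mul_add {S : Set ℤ} (hS : S.Finite) {k : ℕ} (hk : 0 < k) :
    S.ncard = ∑ i ∈ Finset.range k, {m : ℤ | (k : ℤ) * m + i ∈ S}.ncard := by
  have hk' : (0 : ℤ) < k := by exact_mod_cast hk
  rw [Set.ncard_eq_toFinset_card S hS, Finset.card_eq_sum_card_fiberwise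
    (f := fun m : ℤ => (m % k).toNat) (t := Finset.range k)]
  · refine Finset.sum_congr rfl fun i hi => ?_
    have hi' : (i : ℤ) < k := by exact_mod_cast Finset.mem_range.1 hi
    have hinj : Function.Injective fun m : ℤ => (k : ℤ) * m + i := fun x y h => by
      simpa [hk.ne'] using h
    rw [← Set.ncard_coe_finset,
      ← Set.ncard_image_of_injective {m : ℤ | (k : ℤ) * m + i ∈ S} hinj]
    congr 1
    ext m
    simp only [Finset.coe_filter, Set.Finite.mem_toFinset, Set.mem_ofPred_eq, Set.mem_image]
    constructor
    · rintro ⟨hm, rfl⟩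
      have e : (k : ℤ) * (m / k) + ((m % k).toNat : ℤ) = m := by
        rw [Int.toNat_of_nonneg (Int.emod_nonneg _ hk'.ne'), Int.mul_ediv_add_emod]
      exact ⟨m / k, by rwa [e], e⟩
    · rintro ⟨x, hx, rfl⟩
      refine ⟨hx, ?_⟩
      rw [Int.mul_add_emod_self_left, Int.emod_eq_of_lt (by positivity) hi', Int.toNat_natCast]
  · intro m _
    have h1 := Int.emod_nonneg m hk'.ne'
    have h2 := Int.emod_lt_of_pos m hk'
    simp only [Finset.coe_range, Set.mem_Iio]
    omega

/-- for a Maya diagram `M` and `k ≥ 1`, each member `M⁽ⁱ⁾` of the `k`-modular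
decomposition is a Maya diagram, each `Υ(M⁽ⁱ⁾, M⁽ⁱ⁾+1)` is finite of odd cardinality `pᵢ`,
`Υ(M, M+k)` is finite, and `card Υ(M, M+k) = p₀ + ⋯ + p_{k−1}`; i.e. `M` is `(p, k)`-cyclic
with `p = Σᵢ (2gᵢ + 1)`. -/
theorem maya_modular_decomposition_cyclic
    (M : Set ℤ) (hM : IsMayaDiagram M) (k : ℕ) (hk : 1 ≤ k)
    (Mi : ℕ → Set ℤ)
    (hMi : ∀ i, Mi i = {m : ℤ | (k : ℤ) * m + (i : ℤ) ∈ M}) :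
    (∀ i < k, IsMayaDiagram (Mi i)) ∧
    (∀ i < k, (mayaUpsilon (Mi i) ((· + 1) '' Mi i)).Finite ∧
      Odd ((mayaUpsilon (Mi i) ((· + 1) '' Mi i)).ncard)) ∧
    (mayaUpsilon M ((· + (k : ℤ)) '' M)).Finite ∧
    (mayaUpsilon M ((· + (k : ℤ)) '' M)).ncard
      = ∑ i ∈ Finset.range k, (mayaUpsilon (Mi i) ((· + 1) '' Mi i)).ncard := by
  have hk' : (0 : ℤ) < k := by exact_mod_cast hk
  have hMaya : ∀ i, IsMayaDiagram (Mi i) := fun i => by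
    rw [hMi]
    exact hM.preimage_mul_add hk' i
  refine ⟨fun i _ => hMaya i, fun i _ => ⟨(hMaya i).finite_mayaUpsilon_add 1,
    (hMaya i).odd_ncard_mayaUpsilon_add_one⟩, hM.finite_mayaUpsilon_add k, ?_⟩
  rw [ncard_eq_sum_ncard_preimage_mul_add (hM.finite_mayaUpsilon_add k) hk]
  refine Finset.sum_congr rfl fun i _ => congrArg Set.ncard ?_
  ext m
  have e : (k : ℤ) * m + i - k = k * (m - 1) + i := by ring
  rw [Set.mem_ofPred_eq, mem_mayaUpsilon_add, mem_mayaUpsilon_add, hMi, Set.mem_ofPred_eq,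
    Set.mem_ofPred_eq, e]
end
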